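/- Let W be a finite set of n points contained in the cube [0,1]^d in ℝ^d, with d ≥ 2. Then the total edge length of a Euclidean minimum spanning tree of W satisfies E_1(MST(W)) ≤ C_d n^{(d-1)/d} for a constant C_d depending only on d. -/

import Mathlib

open Metric Set Finset

/-- The `α`-weighted total edge length of a graph `G` on a finite point set
`S ⊆ ℝ^d`: the sum of `‖u - v‖^α` over the edges of `G`. -/
noncomputable def treeCost {d : ℕ} (S : Finset (EuclideanSpace ℝ (Fin d)))
    (G : SimpleGraph S) (α : ℝ) : ℝ :=
  letI := Classical.decRel G.Adj
  ∑ e ∈ G.edgeFinset,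
    Sym2.lift ⟨fun (u v : S) => dist (u : EuclideanSpace ℝ (Fin d)) (v : EuclideanSpace ℝ (Fin d)) ^ α,
      fun u v => by simp [dist_comm]⟩ e

/-- `G` is a Euclidean minimum spanning tree on `S`: it is a tree (on vertex set `S`)
of minimal total Euclidean edge length among all trees on `S`. -/
def IsMST {d : ℕ} (S : Finset (EuclideanSpace ℝ (Fin d))) (G : SimpleGraph S) : Prop :=
  G.IsTree ∧ ∀ H : SimpleGraph S, H.IsTree → treeCost S G 1 ≤ treeCost S H 1

theorem aux_cell (m : ℕ) (x : ℝ) (hx : 0 ≤ x) :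
    ((⌈x * m⌉₊ - 1 : ℕ) : ℝ) ≤ x * m ∧ x * m ≤ ((⌈x * m⌉₊ - 1 : ℕ) : ℝ) + 1 := by
  have h0 : 0 ≤ x * m := by positivity
  have h1 := Nat.ceil_lt_add_one h0
  have h2 := Nat.le_ceil (x * m)
  rcases Nat.eq_zero_or_pos ⌈x * m⌉₊ with h | h
  · rw [h] at h2 ⊢
    push_cast at *
    simp at *
    constructor <;> linarith
  · rw [Nat.cast_sub h]
    push_cast
    constructor <;> linarith

theorem aux_pigeon (d : ℕ) (hd : 2 ≤ d) (S : Finset (EuclideanSpace ℝ (Fin d)))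
    (hS : ↑S ⊆ {x : EuclideanSpace ℝ (Fin d) | ∀ i, x i ∈ Set.Icc (0:ℝ) 1})
    (T : Finset S) (hT : 2 ≤ T.card) :
    ∃ u ∈ T, ∃ v ∈ T, u ≠ v ∧
      dist (u : EuclideanSpace ℝ (Fin d)) v ≤ 2 * d * (T.card : ℝ) ^ (-(1 / (d : ℝ))) := by
  have hd0 : (0 : ℝ) < d := by positivity
  have hn : (2 : ℝ) ≤ T.card := by exact_mod_cast hT
  set r : ℝ := (T.card : ℝ) ^ (1 / (d : ℝ)) with hr
  have hr1 : 1 < r := Real.one_lt_rpow (by linarith) (by positivity)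
  set m : ℕ := ⌈r⌉₊ - 1 with hm
  have hc : 1 < ⌈r⌉₊ := by
    rw [Nat.lt_ceil]; simpa using hr1
  have hmr : (m : ℝ) = ⌈r⌉₊ - 1 := by
    rw [hm, Nat.cast_sub hc.le]; simp
  have hm1 : 1 ≤ m := by omega
  have hm1' : (1 : ℝ) ≤ m := by exact_mod_cast hm1
  have hlt : (m : ℝ) < r := by
    have := Nat.ceil_lt_add_one (show 0 ≤ r by linarith)
    linarith
  have hge : r ≤ 2 * m := by
    have := Nat.le_ceil r
    linarith
  have hrd : r ^ d = T.card := by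
    rw [hr, ← Real.rpow_natCast, ← Real.rpow_mul (by positivity)]
    rw [one_div_mul_cancel hd0.ne', Real.rpow_one]
  have hmd : m ^ d < T.card := by
    have : (m : ℝ) ^ d < r ^ d := pow_lt_pow_left₀ hlt (by positivity) (by omega)
    rw [hrd] at this
    exact_mod_cast this
  let f : S → (Fin d → ℕ) := fun x i => ⌈(x : EuclideanSpace ℝ (Fin d)) i * m⌉₊ - 1
  have hmaps : ∀ x ∈ T, f x ∈ Fintype.piFinset (fun _ : Fin d => Finset.range m) := by
    intro x _
    rw [Fintype.mem_piFinset]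
    intro i
    have hx := hS x.2 i
    have : ⌈(x : EuclideanSpace ℝ (Fin d)) i * m⌉₊ ≤ m := by
      rw [Nat.ceil_le]
      nlinarith [hx.2]
    rw [Finset.mem_range]
    show ⌈(x : EuclideanSpace ℝ (Fin d)) i * m⌉₊ - 1 < m
    omega
  obtain ⟨u, hu, v, hv, huv, hf⟩ := Finset.exists_ne_map_eq_of_card_lt_of_maps_to
    (by rw [Fintype.card_piFinset]; simpa using hmd) hmaps
  refine ⟨u, hu, v, hv, huv, ?_⟩
  have hm0 : (0 : ℝ) < m := by linarith
  have hdist : dist (u : EuclideanSpace ℝ (Fin d)) v ≤ d / m := by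
    rw [EuclideanSpace.dist_eq]
    apply Real.sqrt_le_iff.2 ⟨by positivity, ?_⟩
    calc _ ≤ ∑ i : Fin d, (1 / (m : ℝ)) ^ 2 := by
          apply Finset.sum_le_sum
          intro i _
          apply pow_le_pow_left₀ dist_nonneg
          have h1 := aux_cell m _ (hS u.2 i).1
          have h2 := aux_cell m _ (hS v.2 i).1
          have h3 := congrFun hf i
          simp only [f] at h3
          rw [h3] at h1
          rw [Real.dist_eq, le_div_iff₀ hm0, ← abs_of_pos hm0, ← abs_mul, abs_le]
          constructor <;> nlinarith
      _ = d * (1 / (m : ℝ)) ^ 2 := by simp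
      _ ≤ d ^ 2 * (1 / (m : ℝ)) ^ 2 := by
          have : (1 : ℝ) ≤ d := by exact_mod_cast (by omega : 1 ≤ d)
          gcongr
          nlinarith
      _ = _ := by ring
  refine hdist.trans ?_
  rw [Real.rpow_neg (by positivity), ← hr, ← div_eq_mul_inv, div_le_div_iff₀ hm0 (by linarith)]
  nlinarith

theorem aux_arith (d : ℕ) (hd : 2 ≤ d) (k : ℕ) :
    4 * d * (k : ℝ) ^ (((d : ℝ) - 1) / d) + 2 * d * ((k + 1 : ℕ) : ℝ) ^ (-(1 / (d : ℝ))) ≤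
      4 * d * ((k + 1 : ℕ) : ℝ) ^ (((d : ℝ) - 1) / d) := by
  have hd2 : (2 : ℝ) ≤ d := by exact_mod_cast hd
  have hd0 : (0 : ℝ) < d := by linarith
  set p : ℝ := ((d : ℝ) - 1) / d with hp
  have hpp : -(1 / (d : ℝ)) = p - 1 := by rw [hp]; field_simp; ring
  have hp2 : 1 / 2 ≤ p := by rw [hp, div_le_div_iff₀ (by norm_num) hd0]; linarith
  have hp1 : p ≤ 1 := by rw [hp, div_le_one hd0]; linarith
  set n : ℝ := ((k + 1 : ℕ) : ℝ) with hn
  have hkn : (k : ℝ) = n - 1 := by rw [hn]; push_cast; ring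
  have hn1 : 1 ≤ n := by rw [hn]; exact_mod_cast (by omega : 1 ≤ k + 1)
  have hn0 : 0 < n := by linarith
  have hinv : 1 / n ≤ 1 := by rw [div_le_one hn0]; exact hn1
  have hb := rpow_one_add_le_one_add_mul_self (s := -(1 / n)) (p := p) (by linarith)
    (by linarith) hp1
  have hk : (k : ℝ) = n * (1 + -(1 / n)) := by rw [hkn]; field_simp; ring
  have hkp : (k : ℝ) ^ p = n ^ p * (1 + -(1 / n)) ^ p := by
    rw [hk, Real.mul_rpow hn0.le (by linarith)]
  have hnp : n ^ (p - 1) = n ^ p / n := by rw [Real.rpow_sub hn0, Real.rpow_one]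
  rw [hpp, hkp, hnp]
  have hpos : 0 < n ^ p := Real.rpow_pos_of_pos hn0 _
  have h1 : n ^ p * (1 + -(1 / n)) ^ p ≤ n ^ p * (1 + p * -(1 / n)) := by gcongr
  have h2 : n ^ p * (1 + p * -(1 / n)) = n ^ p - p * (n ^ p / n) := by ring
  have h3 : 1 / 2 * (n ^ p / n) ≤ p * (n ^ p / n) := by gcongr
  nlinarith

theorem aux_mono {d : ℕ} (S : Finset (EuclideanSpace ℝ (Fin d)))
    (G H : SimpleGraph S) (h : G ≤ H) : treeCost S G 1 ≤ treeCost S H 1 := by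
  classical
  unfold treeCost
  apply Finset.sum_le_sum_of_subset_of_nonneg
  · intro e he
    exact (@SimpleGraph.mem_edgeFinset _ _ _ _).2
      (SimpleGraph.edgeSet_mono h ((@SimpleGraph.mem_edgeFinset _ _ _ _).1 he))
  · intro e _ _
    induction e using Sym2.ind with
    | _ u v => simp

theorem aux_edge {d : ℕ} (S : Finset (EuclideanSpace ℝ (Fin d)))
    (H : SimpleGraph S) (u v : S) :
    treeCost S (H ⊔ SimpleGraph.edge u v) 1 ≤
      treeCost S H 1 + dist (u : EuclideanSpace ℝ (Fin d)) v := by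
  classical
  unfold treeCost
  have key : ∀ (w : Sym2 S → ℝ) (A B : Finset (Sym2 S)) (a : Sym2 S), (∀ e, 0 ≤ w e) →
      (∀ e ∈ A, e = a ∨ e ∈ B) → ∑ e ∈ A, w e ≤ ∑ e ∈ B, w e + w a := by
    intro w A B a hw hAB
    calc ∑ e ∈ A, w e ≤ ∑ e ∈ insert a B, w e := by
          apply Finset.sum_le_sum_of_subset_of_nonneg
          · intro e he
            rw [Finset.mem_insert]; exact hAB e he
          · intro e _ _; exact hw e
      _ ≤ _ := by
          by_cases ha : a ∈ B
          · rw [Finset.insert_eq_of_mem ha]; linarith [hw a]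
          · rw [Finset.sum_insert ha]; linarith
  refine (key _ _ H.edgeFinset s(u, v) ?_ ?_).trans (le_of_eq ?_)
  rotate_left 2
  · congr 1
    simp
  · intro e
    induction e using Sym2.ind with
    | _ u v => simp
  · intro e
    induction e using Sym2.ind with
    | _ a b =>
      simp only [SimpleGraph.mem_edgeFinset, SimpleGraph.mem_edgeSet, SimpleGraph.sup_adj,
        SimpleGraph.edge_adj, Sym2.eq_iff]
      tauto

theorem aux_build (d : ℕ) (hd : 2 ≤ d) (S : Finset (EuclideanSpace ℝ (Fin d)))
    (hS : ↑S ⊆ {x : EuclideanSpace ℝ (Fin d) | ∀ i, x i ∈ Set.Icc (0:ℝ) 1}) (n : ℕ) :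
    ∀ T : Finset S, T.card = n → ∃ H : SimpleGraph S,
      (∀ u ∈ T, ∀ v ∈ T, H.Reachable u v) ∧
      treeCost S H 1 ≤ 4 * d * (n : ℝ) ^ (((d : ℝ) - 1) / d) := by
  classical
  induction n with
  | zero =>
    intro T hT
    refine ⟨⊥, ?_, ?_⟩
    · rw [Finset.card_eq_zero] at hT; simp [hT]
    · have : treeCost S ⊥ 1 = 0 := by
        unfold treeCost
        apply Finset.sum_eq_zero
        intro e he
        have he := (@SimpleGraph.mem_edgeFinset _ _ _ (_)).1 he
        simp at he
      rw [this]; positivity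
  | succ k ih =>
    intro T hT
    rcases Nat.lt_or_ge T.card 2 with h | h
    · obtain ⟨H, -, hH⟩ := (show ∃ H : SimpleGraph S, True ∧ treeCost S H 1 ≤
          4 * d * ((k + 1 : ℕ) : ℝ) ^ (((d : ℝ) - 1) / d) from by
        refine ⟨⊥, trivial, ?_⟩
        have : treeCost S ⊥ 1 = 0 := by
          unfold treeCost
          apply Finset.sum_eq_zero
          intro e he
          have he := (@SimpleGraph.mem_edgeFinset _ _ _ (_)).1 he
          simp at he
        rw [this]; positivity)
      refine ⟨H, ?_, hH⟩
      intro u hu v hv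
      have := Finset.card_le_one.1 (by omega : T.card ≤ 1) u hu v hv
      rw [this]
    · obtain ⟨u, hu, v, hv, huv, hdist⟩ := aux_pigeon d hd S hS T h
      obtain ⟨H, hR, hH⟩ := ih (T.erase u) (by rw [Finset.card_erase_of_mem hu, hT]; rfl)
      have hle : H ≤ H ⊔ SimpleGraph.edge u v := le_sup_left
      have huv' : (H ⊔ SimpleGraph.edge u v).Reachable u v := by
        apply SimpleGraph.Adj.reachable
        rw [SimpleGraph.sup_adj, SimpleGraph.edge_adj]
        right; exact ⟨Or.inl ⟨rfl, rfl⟩, huv⟩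
      have hall : ∀ w ∈ T, (H ⊔ SimpleGraph.edge u v).Reachable w v := by
        intro w hw
        by_cases hwu : w = u
        · rw [hwu]; exact huv'
        · exact (hR w (Finset.mem_erase.2 ⟨hwu, hw⟩) v
            (Finset.mem_erase.2 ⟨huv.symm, hv⟩)).mono hle
      refine ⟨H ⊔ SimpleGraph.edge u v, fun a ha b hb => (hall a ha).trans (hall b hb).symm, ?_⟩
      rw [hT] at hdist
      have := aux_arith d hd k
      have := aux_edge S H u v
      linarith

/-- Classical bound: the total edge length of a Euclidean minimum spanning tree of
`n` points in the unit cube `[0,1]^d` (with `d ≥ 2`) is at most `C_d n^{(d-1)/d}`,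
with `C_d` depending only on `d`. -/
theorem stmt11 (d : ℕ) (hd : 2 ≤ d) :
    ∃ C : ℝ, 0 < C ∧
      ∀ S : Finset (EuclideanSpace ℝ (Fin d)),
        (↑S ⊆ {x : EuclideanSpace ℝ (Fin d) | ∀ i, x i ∈ Set.Icc (0:ℝ) 1}) →
        ∀ G : SimpleGraph S, IsMST S G →
          treeCost S G 1 ≤ C * (S.card : ℝ) ^ (((d : ℝ) - 1) / d) := by
  have hd0 : (0 : ℝ) < d := by positivity
  refine ⟨4 * d, by positivity, ?_⟩
  intro S hS G hG
  obtain ⟨H, hR, hH⟩ := aux_build d hd S hS S.card Finset.univ (by simp)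
  have hne : Nonempty S := hG.1.1.nonempty
  have hconn : H.Connected := ⟨fun u v => hR u (Finset.mem_univ _) v (Finset.mem_univ _)⟩
  obtain ⟨T, hTH, hT⟩ := hconn.exists_isTree_le
  exact (hG.2 T hT).trans ((aux_mono S T H hTH).trans hH)
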